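/- Let E be a complex normed space, U ⊆ E open, and Γ : E → (E →L[ℂ] E →L[ℂ] E) differentiable on U. Let Y₁,…,Y_n : E → E be vector fields, differentiable and horizontal on U, such that for every p ∈ U the vectors Y₁(p),…,Y_n(p) span E, and such that every Lie bracket [Yᵢ,Yⱼ] is horizontal on U. Then the torsion is parallel: (∇Tor)(p)(u)(v)(w) = 0 for all p ∈ U and u,v,w ∈ E. -/

import Mathlib

open VectorField

variable {E : Type*} [NormedAddCommGroup E] [NormedSpace ℂ E]

/-- The torsion of the connection with Christoffel map `Γ`. -/
noncomputable def torsion (Γ : E → (E →L[ℂ] E →L[ℂ] E)) (p : E) (u v : E) : E :=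
  Γ p u v - Γ p v u

/-- The covariant derivative of the torsion of the connection with Christoffel map `Γ`. -/
noncomputable def nablaTorsion (Γ : E → (E →L[ℂ] E →L[ℂ] E)) (p : E) (u v w : E) : E :=
  fderiv ℂ (fun q => torsion Γ q v w) p u + Γ p u (torsion Γ p v w)
    - torsion Γ p (Γ p u v) w - torsion Γ p v (Γ p u w)

/-- The torsion as a map into the continuous bilinear maps. -/
noncomputable def torsionCLM (Γ : E → (E →L[ℂ] E →L[ℂ] E)) (p : E) : E →L[ℂ] E →L[ℂ] E :=
  Γ p - (Γ p).flip

theorem torsionCLM_apply (Γ : E → (E →L[ℂ] E →L[ℂ] E)) (p u v : E) :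
    torsionCLM Γ p u v = torsion Γ p u v := rfl

theorem differentiableAt_torsionCLM {Γ : E → (E →L[ℂ] E →L[ℂ] E)} {p : E}
    (hΓ : DifferentiableAt ℂ Γ p) :
    DifferentiableAt ℂ (torsionCLM Γ) p := by
  have hflip : DifferentiableAt ℂ (fun q => (Γ q).flip) p :=
    (ContinuousLinearMap.flipₗᵢ ℂ E E E).differentiable.differentiableAt.comp p hΓ
  exact DifferentiableAt.fun_sub (𝕜 := ℂ) (E := E) (F := E →L[ℂ] E →L[ℂ] E) hΓ hflip

/-- The derivative of the torsion evaluated on two differentiable vector fields. -/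
theorem fderiv_torsion_apply {Γ : E → (E →L[ℂ] E →L[ℂ] E)} {p : E}
    (hΓ : DifferentiableAt ℂ Γ p) {V W : E → E} (hV : DifferentiableAt ℂ V p)
    (hW : DifferentiableAt ℂ W p) (u : E) :
    fderiv ℂ (fun q => torsion Γ q (V q) (W q)) p u =
      fderiv ℂ (torsionCLM Γ) p u (V p) (W p) + torsion Γ p (fderiv ℂ V p u) (W p)
        + torsion Γ p (V p) (fderiv ℂ W p u) := by
  have h := ((differentiableAt_torsionCLM hΓ).hasFDerivAt.clm_apply hV.hasFDerivAt).clm_apply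
    hW.hasFDerivAt
  have h' := congrArg (fun L : E →L[ℂ] E => L u) h.fderiv
  simp only [torsionCLM_apply] at h'
  rw [h']
  simp only [add_apply, ContinuousLinearMap.comp_apply,
    ContinuousLinearMap.flip_apply, torsionCLM_apply]
  abel

theorem nablaTorsion_eq {Γ : E → (E →L[ℂ] E →L[ℂ] E)} {p : E}
    (hΓ : DifferentiableAt ℂ Γ p) (u v w : E) :
    nablaTorsion Γ p u v w =
      fderiv ℂ (torsionCLM Γ) p u v w + Γ p u (torsionCLM Γ p v w)
        - torsionCLM Γ p (Γ p u v) w - torsionCLM Γ p v (Γ p u w) := by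
  have h := fderiv_torsion_apply hΓ (differentiableAt_const v) (differentiableAt_const w) u
  rw [nablaTorsion, h]
  simp only [← torsionCLM_apply, fderiv_fun_const, Pi.zero_apply,
    zero_apply, map_zero, add_zero]

/-- The covariant derivative of the torsion vanishes as soon as it vanishes on a spanning family. -/
theorem nablaTorsion_eq_zero_of_span {Γ : E → (E →L[ℂ] E →L[ℂ] E)} {p : E}
    (hΓ : DifferentiableAt ℂ Γ p) {s : Set E} (hs : Submodule.span ℂ s = ⊤) {u : E}
    (h : ∀ v ∈ s, ∀ w ∈ s, nablaTorsion Γ p u v w = 0) (v w : E) :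
    nablaTorsion Γ p u v w = 0 := by
  let B : E →ₗ[ℂ] E →ₗ[ℂ] E := LinearMap.mk₂ ℂ (nablaTorsion Γ p u)
    (fun _ _ _ => by
      simp only [nablaTorsion_eq hΓ, map_add, add_apply]; abel)
    (fun _ _ _ => by
      simp only [nablaTorsion_eq hΓ, map_smul, smul_apply, smul_sub, smul_add])
    (fun _ _ _ => by
      simp only [nablaTorsion_eq hΓ, map_add]; abel)
    (fun _ _ _ => by
      simp only [nablaTorsion_eq hΓ, map_smul, smul_sub, smul_add])
  have hB : B = 0 := LinearMap.ext_on hs fun v hv => LinearMap.ext_on hs fun w hw => h v hv w hw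
  exact LinearMap.congr_fun₂ hB v w

/-- The Lie bracket of two horizontal vector fields is minus their torsion. -/
theorem lieBracket_eq_neg_torsion {Γ : E → (E →L[ℂ] E →L[ℂ] E)} {V W : E → E} {p : E}
    (hV : ∀ u, fderiv ℂ V p u + Γ p u (V p) = 0) (hW : ∀ u, fderiv ℂ W p u + Γ p u (W p) = 0) :
    lieBracket ℂ V W p = -torsion Γ p (V p) (W p) := by
  rw [lieBracket, eq_neg_of_add_eq_zero_left (hV _), eq_neg_of_add_eq_zero_left (hW _), torsion]
  abel

/-- Implication (1) ⇒ (3) of Proposition 3.8: a connection admitting a spanning horizontal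
frame closed under Lie bracket has parallel torsion. -/
theorem stmt4
    (U : Set E) (hU : IsOpen U)
    (Γ : E → (E →L[ℂ] E →L[ℂ] E)) (hΓ : ∀ p ∈ U, DifferentiableAt ℂ Γ p)
    (n : ℕ) (Y : Fin n → E → E)
    (hYdiff : ∀ i, ∀ p ∈ U, DifferentiableAt ℂ (Y i) p)
    (hYhor : ∀ i, ∀ p ∈ U, ∀ u : E, fderiv ℂ (Y i) p u + Γ p u (Y i p) = 0)
    (hYspan : ∀ p ∈ U, Submodule.span ℂ (Set.range fun i => Y i p) = ⊤)
    (hbrhor : ∀ i j, ∀ p ∈ U, ∀ u : E,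
      fderiv ℂ (lieBracket ℂ (Y i) (Y j)) p u + Γ p u (lieBracket ℂ (Y i) (Y j) p) = 0) :
    ∀ p ∈ U, ∀ u v w : E, nablaTorsion Γ p u v w = 0 := by
  intro p hp u
  refine nablaTorsion_eq_zero_of_span (hΓ p hp) (hYspan p hp) ?_
  rintro _ ⟨i, rfl⟩ _ ⟨j, rfl⟩
  have hbr : ∀ q ∈ U, lieBracket ℂ (Y i) (Y j) q = -torsion Γ q (Y i q) (Y j q) := fun q hq =>
    lieBracket_eq_neg_torsion (hYhor i q hq) (hYhor j q hq)
  have hev : lieBracket ℂ (Y i) (Y j) =ᶠ[nhds p] fun q => -torsion Γ q (Y i q) (Y j q) :=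
    Filter.eventually_of_mem (hU.mem_nhds hp) hbr
  have h := hbrhor i j p hp u
  rw [hev.fderiv_eq, hbr p hp, fderiv_fun_neg, neg_apply,
    fderiv_torsion_apply (hΓ p hp) (hYdiff i p hp) (hYdiff j p hp),
    eq_neg_of_add_eq_zero_left (hYhor i p hp u), eq_neg_of_add_eq_zero_left (hYhor j p hp u)] at h
  simp only [← torsionCLM_apply, map_neg, neg_apply] at h
  rw [nablaTorsion_eq (hΓ p hp), ← neg_eq_zero, ← h]
  abel
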